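/- arXiv:1805.10957 — 2 statements merged into one kernel-verified Lean document; each statement's English description precedes it below -/
import Mathlib

section
/- If two circles C and D in the plane intersect in exactly two points, then the set of points of C lying in the open disk of D and the set of points of C lying outside the closed disk of D are both nonempty and both connected (each is an open arc of C). -/
noncomputable section

/-- The Euclidean plane. -/
abbrev E2 := EuclideanSpace ℝ (Fin 2)

theorem mem_sphere_coord (c x : E2) (r : ℝ) (hr : 0 < r) :
    x ∈ Metric.sphere c r ↔ (x 0 - c 0)^2 + (x 1 - c 1)^2 = r^2 := by
  rw [Metric.mem_sphere, EuclideanSpace.dist_eq, Real.sqrt_eq_iff_mul_self_eq_of_pos hr, ← pow_two,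
    eq_comm]
  simp [Fin.sum_univ_two, Real.dist_eq, sq_abs]

theorem mem_ball_coord (c x : E2) (r : ℝ) (hr : 0 < r) :
    x ∈ Metric.ball c r ↔ (x 0 - c 0)^2 + (x 1 - c 1)^2 < r^2 := by
  rw [Metric.mem_ball, EuclideanSpace.dist_eq, Real.sqrt_lt' hr]
  simp [Fin.sum_univ_two, Real.dist_eq, sq_abs]

theorem mem_closedBall_compl_coord (c x : E2) (r : ℝ) (hr : 0 < r) :
    x ∈ (Metric.closedBall c r)ᶜ ↔ r^2 < (x 0 - c 0)^2 + (x 1 - c 1)^2 := by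
  rw [Set.mem_compl_iff, Metric.mem_closedBall, EuclideanSpace.dist_eq,
    Real.sqrt_le_left hr.le, not_le]
  simp [Fin.sum_univ_two, Real.dist_eq, sq_abs]

theorem exists_angle (a b : ℝ) (h : a^2 + b^2 = 1) :
    ∃ t : ℝ, |t| ≤ Real.pi ∧ Real.cos t = a ∧ Real.sin t = b := by
  have hn : ‖(⟨a, b⟩ : ℂ)‖ = 1 := by
    rw [Complex.norm_def, Complex.normSq_mk, Real.sqrt_eq_one]; linarith
  have h0 : (⟨a, b⟩ : ℂ) ≠ 0 := by
    intro h0; rw [h0] at hn; simp at hn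
  refine ⟨Complex.arg ⟨a, b⟩, Complex.abs_arg_le_pi _, ?_, ?_⟩
  · rw [Complex.cos_arg h0, hn]; simp
  · rw [Complex.sin_arg, hn]; simp

theorem arc_connected (c : E2) (r : ℝ) (hr : 0 < r) (u v k : ℝ) (huv : u^2 + v^2 = 1)
    (hk : -1 < k) (hk' : k < 1) :
    IsConnected {x : E2 | (x 0 - c 0)^2 + (x 1 - c 1)^2 = r^2 ∧
      r * k < u * (x 0 - c 0) + v * (x 1 - c 1)} := by
  have hpos : 0 < Real.arccos k := Real.arccos_pos.2 hk'
  have hcos : Real.cos (Real.arccos k) = k := Real.cos_arccos hk.le hk'.le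
  have key : {x : E2 | (x 0 - c 0)^2 + (x 1 - c 1)^2 = r^2 ∧
      r * k < u * (x 0 - c 0) + v * (x 1 - c 1)} =
      Set.image (fun t : ℝ => (!₂[c 0 + r * (Real.cos t * u - Real.sin t * v),
        c 1 + r * (Real.cos t * v + Real.sin t * u)] : E2))
        (Set.Ioo (-Real.arccos k) (Real.arccos k)) := by
    ext x
    simp only [Set.mem_ofPred_eq, Set.mem_image, Set.mem_Ioo, ← abs_lt]
    constructor
    · rintro ⟨h1, h2⟩
      obtain ⟨t, ht, hc, hs⟩ := exists_angle ((u * (x 0 - c 0) + v * (x 1 - c 1)) / r)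
        ((u * (x 1 - c 1) - v * (x 0 - c 0)) / r) (by
          field_simp
          linear_combination (u^2+v^2) * h1 + r^2 * huv)
      refine ⟨t, ?_, ?_⟩
      · by_contra hlt
        have := Real.cos_le_cos_of_nonneg_of_le_pi hpos.le ht (not_lt.1 hlt)
        rw [Real.cos_abs, hcos, hc, div_le_iff₀ hr] at this
        linarith
      · rw [hc, hs]
        ext i
        fin_cases i
        · simp
          field_simp
          linear_combination (x 0 - c 0) * huv
        · simp
          field_simp
          linear_combination (x 1 - c 1) * huv
    · rintro ⟨t, ht, rfl⟩
      have h3 := Real.cos_lt_cos_of_nonneg_of_le_pi (abs_nonneg t) (Real.arccos_le_pi k) ht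
      rw [Real.cos_abs, hcos] at h3
      have h4 := Real.sin_sq_add_cos_sq t
      simp
      constructor
      · linear_combination r^2 * (u^2+v^2) * h4 + r^2 * huv
      · have : u * (r * (Real.cos t * u - Real.sin t * v)) +
          v * (r * (Real.cos t * v + Real.sin t * u)) = r * Real.cos t := by
          linear_combination r * Real.cos t * huv
        rw [this]
        exact mul_lt_mul_of_pos_left h3 hr
  rw [key]
  refine (isConnected_Ioo (by linarith)).image _ (Continuous.continuousOn ?_)
  refine (PiLp.continuous_toLp 2 _).comp (continuous_pi fun i => ?_)
  fin_cases i
  · simp; fun_prop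
  · simp; fun_prop

/-- If two circles `C` and `D` in the plane intersect in exactly two points, then the set of
points of `C` lying in the open disk of `D` and the set of points of `C` lying outside the
closed disk of `D` are both nonempty and both connected. -/
theorem stmt1 (c d : E2) (r s : ℝ) (hr : 0 < r) (hs : 0 < s)
    (htwo : ∃ p q : E2, p ≠ q ∧ Metric.sphere c r ∩ Metric.sphere d s = {p, q}) :
    (Metric.sphere c r ∩ Metric.ball d s).Nonempty ∧
    (Metric.sphere c r ∩ (Metric.closedBall d s)ᶜ).Nonempty ∧
    IsConnected (Metric.sphere c r ∩ Metric.ball d s) ∧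
    IsConnected (Metric.sphere c r ∩ (Metric.closedBall d s)ᶜ) := by
  obtain ⟨p, q, hpq, hS⟩ := htwo
  have hp : p ∈ Metric.sphere c r ∩ Metric.sphere d s := by rw [hS]; simp
  have hq : q ∈ Metric.sphere c r ∩ Metric.sphere d s := by rw [hS]; simp
  have hcd : c ≠ d := by
    rintro rfl
    have hrs : r = s := by rw [← hp.1, ← hp.2]
    subst hrs
    rw [Set.inter_self] at hS
    have m1 : (!₂[c 0 + r, c 1] : E2) ∈ ({p, q} : Set E2) := by
      rw [← hS, mem_sphere_coord _ _ _ hr]; simp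
    have m2 : (!₂[c 0 - r, c 1] : E2) ∈ ({p, q} : Set E2) := by
      rw [← hS, mem_sphere_coord _ _ _ hr]; simp
    have m3 : (!₂[c 0, c 1 + r] : E2) ∈ ({p, q} : Set E2) := by
      rw [← hS, mem_sphere_coord _ _ _ hr]; simp
    have n12 : (!₂[c 0 + r, c 1] : E2) ≠ !₂[c 0 - r, c 1] := by
      intro h
      have := congrArg (fun z : E2 => z 0) h
      simp at this
      linarith
    have n13 : (!₂[c 0 + r, c 1] : E2) ≠ !₂[c 0, c 1 + r] := by
      intro h
      have := congrArg (fun z : E2 => z 0) h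
      simp at this
      linarith
    have n23 : (!₂[c 0 - r, c 1] : E2) ≠ !₂[c 0, c 1 + r] := by
      intro h
      have := congrArg (fun z : E2 => z 0) h
      simp at this
      linarith
    simp only [Set.mem_insert_iff, Set.mem_singleton_iff] at m1 m2 m3
    grind
  obtain ⟨ρ, hρ, hρ2⟩ : ∃ ρ : ℝ, 0 < ρ ∧ (d 0 - c 0)^2 + (d 1 - c 1)^2 = ρ^2 := by
    refine ⟨dist d c, dist_pos.2 hcd.symm, ?_⟩
    rw [← mem_sphere_coord _ _ _ (dist_pos.2 hcd.symm)]
    rfl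
  obtain ⟨u, hu⟩ : ∃ u, d 0 - c 0 = ρ * u := ⟨(d 0 - c 0) / ρ, by field_simp⟩
  obtain ⟨v, hv⟩ : ∃ v, d 1 - c 1 = ρ * v := ⟨(d 1 - c 1) / ρ, by field_simp⟩
  have huv : u^2 + v^2 = 1 := by
    rw [hu, hv] at hρ2
    have : ρ^2 * (u^2 + v^2) = ρ^2 * 1 := by linarith
    exact mul_left_cancel₀ (by positivity) this
  obtain ⟨k, hk⟩ : ∃ k, r^2 + ρ^2 - s^2 = 2 * ρ * (r * k) :=
    ⟨(r^2 + ρ^2 - s^2) / (2 * ρ * r), by field_simp⟩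
  have hd0 : d 0 = c 0 + ρ * u := by linarith
  have hd1 : d 1 = c 1 + ρ * v := by linarith
  have expand : ∀ x : E2, (x 0 - c 0)^2 + (x 1 - c 1)^2 = r^2 →
      (x 0 - d 0)^2 + (x 1 - d 1)^2 - s^2 =
        2 * ρ * (r * k - (u * (x 0 - c 0) + v * (x 1 - c 1))) := by
    intro x hx
    rw [hd0, hd1]
    linear_combination hx + hk + ρ^2 * huv
  have lin : ∀ x ∈ Metric.sphere c r ∩ Metric.sphere d s,
      (u * (x 0 - c 0) + v * (x 1 - c 1)) = r * k ∧
      (u * (x 1 - c 1) - v * (x 0 - c 0))^2 = r^2 * (1 - k^2) := by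
    rintro x ⟨h1, h2⟩
    rw [mem_sphere_coord _ _ _ hr] at h1
    rw [mem_sphere_coord _ _ _ hs] at h2
    have h3 := expand x h1
    rw [h2, sub_self] at h3
    have h4 : r * k - (u * (x 0 - c 0) + v * (x 1 - c 1)) = 0 := by
      rcases mul_eq_zero.1 h3.symm with h | h
      · linarith
      · exact h
    have h5 : (u * (x 0 - c 0) + v * (x 1 - c 1)) = r * k := by linarith
    refine ⟨h5, ?_⟩
    have : (u * (x 1 - c 1) - v * (x 0 - c 0))^2 = r^2 -
        (u * (x 0 - c 0) + v * (x 1 - c 1))^2 := by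
      linear_combination (u^2 + v^2) * h1 + r^2 * huv
    rw [this, h5]; ring
  have hk1 : k^2 < 1 := by
    by_contra hge
    push Not at hge
    obtain ⟨p1, p2⟩ := lin p hp
    obtain ⟨q1, q2⟩ := lin q hq
    have hle : r^2 * (1 - k^2) ≤ 0 :=
      mul_nonpos_of_nonneg_of_nonpos (by positivity) (by linarith)
    have p3 : u * (p 1 - c 1) - v * (p 0 - c 0) = 0 := by
      apply pow_eq_zero_iff (two_ne_zero) |>.1
      exact le_antisymm (by linarith) (sq_nonneg _)
    have q3 : u * (q 1 - c 1) - v * (q 0 - c 0) = 0 := by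
      apply pow_eq_zero_iff (two_ne_zero) |>.1
      exact le_antisymm (by linarith) (sq_nonneg _)
    apply hpq
    ext i
    fin_cases i
    · show p 0 = q 0
      linear_combination u * (p1 - q1) - v * (p3 - q3) - (p 0 - q 0) * huv
    · show p 1 = q 1
      linear_combination v * (p1 - q1) + u * (p3 - q3) - (p 1 - q 1) * huv
  obtain ⟨hkl, hku⟩ := abs_lt.1 ((sq_lt_one_iff_abs_lt_one k).1 hk1)
  have A := arc_connected c r hr u v k huv hkl hku
  have B := arc_connected c r hr (-u) (-v) (-k) (by linarith [huv, neg_sq u, neg_sq v])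
    (by linarith) (by linarith)
  have eA : Metric.sphere c r ∩ Metric.ball d s = {x : E2 | (x 0 - c 0)^2 + (x 1 - c 1)^2 = r^2 ∧
      r * k < u * (x 0 - c 0) + v * (x 1 - c 1)} := by
    ext x
    rw [Set.mem_inter_iff, mem_sphere_coord _ _ _ hr, mem_ball_coord _ _ _ hs, Set.mem_ofPred_eq]
    refine and_congr_right fun hx => ?_
    have h := expand x hx
    constructor
    · intro h1
      by_contra h2
      have := mul_nonneg (by positivity : 0 ≤ 2 * ρ) (sub_nonneg.2 (not_lt.1 h2))
      linarith
    · intro h1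
      have := mul_pos (by positivity : 0 < 2 * ρ) (sub_pos.2 h1)
      linarith
  have eB : Metric.sphere c r ∩ (Metric.closedBall d s)ᶜ =
      {x : E2 | (x 0 - c 0)^2 + (x 1 - c 1)^2 = r^2 ∧
      r * (-k) < (-u) * (x 0 - c 0) + (-v) * (x 1 - c 1)} := by
    ext x
    rw [Set.mem_inter_iff, mem_sphere_coord _ _ _ hr, mem_closedBall_compl_coord _ _ _ hs,
      Set.mem_ofPred_eq]
    refine and_congr_right fun hx => ?_
    have h := expand x hx
    constructor
    · intro h1
      by_contra h2
      have := mul_nonneg (by positivity : 0 ≤ 2 * ρ) (sub_nonneg.2 (not_lt.1 h2))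
      linarith
    · intro h1
      have := mul_pos (by positivity : 0 < 2 * ρ) (sub_pos.2 h1)
      linarith
  rw [eA, eB]
  exact ⟨A.nonempty, B.nonempty, A, B⟩
end
end

section
/- For every integer n ≥ 1 there exists an integer N with the following property. Let Q be an arrangement of at least N circles in ℝ² in which every triple is NonKrupp. Then there exist distinct circles C_0, C_1, …, C_n in Q such that: (I) either every intersection point of C_i and C_j with 1 ≤ i < j ≤ n lies in the open disk of C_0, or every such point lies strictly outside the closed disk of C_0; (II) for all distinct i, j ∈ {1, …, n}, the two points of C_0 ∩ C_i lie in the same connected component of C_0 \ (C_0 ∩ C_j); and (III) for all 1 ≤ i < j < k ≤ n, the two points of C_0 ∩ C_i and the two points of C_0 ∩ C_k lie in different connected components of C_0 \ (C_0 ∩ C_j). -/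
noncomputable section

/-- The circle with center `c` and radius `r` separates the points `p` and `q`
(not lying on it) if exactly one of them lies in its open disk. -/
def Separates (c : E2) (r : ℝ) (p q : E2) : Prop :=
  Xor' (p ∈ Metric.ball c r) (q ∈ Metric.ball c r)

/-- The circle with center `c`, radius `r` does not separate the two intersection points of
the other two circles. -/
def NonSepInt (c : E2) (r : ℝ) (c₁ : E2) (r₁ : ℝ) (c₂ : E2) (r₂ : ℝ) : Prop :=
  ∀ p q : E2, p ≠ q → Metric.sphere c₁ r₁ ∩ Metric.sphere c₂ r₂ = {p, q} →
    ¬ Separates c r p q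


theorem ramsey_set {α K : Type*} [LinearOrder α] [Fintype K] (r : ℕ) :
    ∀ m : ℕ, ∃ N : ℕ, ∀ S : Finset α, N ≤ S.card → ∀ f : Finset α → K,
      ∃ T ⊆ S, T.card = m ∧ ∃ c, ∀ A ⊆ T, A.card = r → f A = c := by
  classical
  induction r with
  | zero =>
    intro m
    refine ⟨m, fun S hS f => ?_⟩
    obtain ⟨T, hT, hc⟩ := Finset.exists_subset_card_eq hS
    refine ⟨T, hT, hc, f ∅, fun A _ h => ?_⟩
    rw [Finset.card_eq_zero.1 h]
  | succ r ih =>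
    have key : ∀ t : ℕ, ∃ N : ℕ, ∀ S : Finset α, N ≤ S.card → ∀ f : Finset α → K,
        ∃ T ⊆ S, T.card = t ∧ ∃ g : α → K, ∀ a ∈ T, ∀ A ⊆ T, A.card = r →
          (∀ b ∈ A, a < b) → f (insert a A) = g a := by
      intro t
      induction t with
      | zero =>
        exact ⟨0, fun S _ f => ⟨∅, by simp, by simp, fun _ => f ∅, by simp⟩⟩
      | succ t iht =>
        obtain ⟨N₁, hN₁⟩ := iht
        obtain ⟨N₂, hN₂⟩ := ih N₁
        refine ⟨N₂ + 1, fun S hS f => ?_⟩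
        have hne : S.Nonempty := Finset.card_pos.1 (by omega)
        set a := S.min' hne with ha
        have haS : a ∈ S := Finset.min'_mem _ _
        obtain ⟨S₂, hS₂, hc₂, c, hcol⟩ := hN₂ (S.erase a)
          (by rw [Finset.card_erase_of_mem haS]; omega) (fun A => f (insert a A))
        obtain ⟨T, hT, hcT, g, hg⟩ := hN₁ S₂ hc₂.ge f
        have hTS : T ⊆ S.erase a := hT.trans hS₂
        have hlt : ∀ b ∈ T, a < b := fun b hb => by
          have := hTS hb
          rw [Finset.mem_erase] at this
          exact lt_of_le_of_ne (Finset.min'_le _ _ this.2) (Ne.symm this.1)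
        have haT : a ∉ T := fun h => lt_irrefl _ (hlt a h)
        refine ⟨insert a T, ?_, ?_, fun x => if x = a then c else g x, ?_⟩
        · intro x hx
          rcases Finset.mem_insert.1 hx with rfl | hx
          · exact haS
          · exact Finset.mem_of_mem_erase (hTS hx)
        · rw [Finset.card_insert_of_notMem haT, hcT]
        · intro b hb A hA hAc hlt'
          have hAT : A ⊆ T := by
            intro x hx
            rcases Finset.mem_insert.1 (hA hx) with rfl | h
            · exfalso
              rcases Finset.mem_insert.1 hb with rfl | hb
              · exact lt_irrefl _ (hlt' _ hx)
              · exact lt_asymm (hlt' _ hx) (hlt _ hb)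
            · exact h
          rcases Finset.mem_insert.1 hb with rfl | hb
          · simp only [if_true]
            exact hcol A (hAT.trans hT) hAc
          · have : b ≠ a := fun h => haT (h ▸ hb)
            simp only [this, if_false]
            exact hg b hb A hAT hAc hlt'
    intro m
    obtain ⟨N, hN⟩ := key (Fintype.card K * m)
    refine ⟨N + 1, fun S hS f => ?_⟩
    obtain ⟨T, hT, hcT, g, hg⟩ := hN S (by omega) f
    have : Nonempty K := ⟨f ∅⟩
    obtain ⟨c, -, hc⟩ := Finset.exists_le_card_fiber_of_mul_le_card_of_maps_to
      (s := T) (t := (Finset.univ : Finset K)) (f := g) (n := m) (by simp)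
      Finset.univ_nonempty (by rw [hcT, Finset.card_univ])
    obtain ⟨T', hT', hcT'⟩ := Finset.exists_subset_card_eq hc
    refine ⟨T', fun x hx => hT (Finset.mem_filter.1 (hT' hx)).1, hcT', c, ?_⟩
    intro A hA hAc
    have hne : A.Nonempty := Finset.card_pos.1 (by omega)
    have ha := Finset.min'_mem A hne
    set a := A.min' hne
    have hm := Finset.mem_filter.1 (hT' (hA ha))
    rw [← Finset.insert_erase ha, hg a hm.1 (A.erase a), hm.2]
    · intro x hx
      exact (Finset.mem_filter.1 (hT' (hA (Finset.mem_of_mem_erase hx)))).1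
    · rw [Finset.card_erase_of_mem ha]; omega
    · intro b hb
      rw [Finset.mem_erase] at hb
      exact lt_of_le_of_ne (Finset.min'_le _ _ hb.2) (Ne.symm hb.1)

theorem sorted_triple_unique {x y z i j k : ℕ} (h1 : x < y) (h2 : y < z) (h3 : i < j) (h4 : j < k)
    (h : ({x, y, z} : Finset ℕ) = {i, j, k}) : x = i ∧ y = j ∧ z = k := by
  have e1 : x = i ∨ x = j ∨ x = k := by
    have : x ∈ ({x, y, z} : Finset ℕ) := by simp
    rw [h] at this; simpa using this
  have e2 : y = i ∨ y = j ∨ y = k := by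
    have : y ∈ ({x, y, z} : Finset ℕ) := by simp
    rw [h] at this; simpa using this
  have e3 : z = i ∨ z = j ∨ z = k := by
    have : z ∈ ({x, y, z} : Finset ℕ) := by simp
    rw [h] at this; simpa using this
  omega

theorem ramsey_triple {K : Type} [Fintype K] (m : ℕ) :
    ∃ N : ℕ, ∀ M : ℕ, N ≤ M → ∀ F : Fin M → Fin M → Fin M → K,
      ∃ e : Fin m → Fin M, StrictMono e ∧ ∀ i j k i' j' k', i < j → j < k → i' < j' → j' < k' →
        F (e i) (e j) (e k) = F (e i') (e j') (e k') := by
  classical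
  obtain ⟨N, hN⟩ := ramsey_set (α := ℕ) (K := Option K) 3 m
  refine ⟨N, fun M hM F => ?_⟩
  obtain ⟨T, hT, hcT, c, hc⟩ := hN (Finset.range M) (by simpa using hM)
    (fun A => if h : ∃ i j k : Fin M, i < j ∧ j < k ∧ A = {i.val, j.val, k.val} then
      some (F h.choose h.choose_spec.choose h.choose_spec.choose_spec.choose) else none)
  have hlt : ∀ i, T.orderEmbOfFin hcT i < M := fun i =>
    Finset.mem_range.1 (hT (Finset.orderEmbOfFin_mem T hcT i))
  have hmono : StrictMono (fun i => (⟨T.orderEmbOfFin hcT i, hlt i⟩ : Fin M)) := by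
    intro i j hij
    exact (T.orderEmbOfFin hcT).strictMono hij
  have hmem : ∀ i, T.orderEmbOfFin hcT i ∈ T := fun i => Finset.orderEmbOfFin_mem T hcT i
  have H : ∀ x y z : Fin M, x.val ∈ T → y.val ∈ T → z.val ∈ T → x < y → y < z →
      some (F x y z) = c := by
    intro x y z m1 m2 m3 h1 h2
    have h1' : x.val < y.val := h1
    have h2' : y.val < z.val := h2
    have hA := hc {x.val, y.val, z.val}
      (by intro w; simp only [Finset.mem_insert, Finset.mem_singleton]
          rintro (rfl | rfl | rfl) <;> assumption)
      (by rw [Finset.card_eq_three]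
          exact ⟨x.val, y.val, z.val, by omega, by omega, by omega, rfl⟩)
    have hex : ∃ i j k : Fin M, i < j ∧ j < k ∧
        ({x.val, y.val, z.val} : Finset ℕ) = {i.val, j.val, k.val} :=
      ⟨x, y, z, h1, h2, rfl⟩
    rw [dif_pos hex] at hA
    rw [← hA]
    obtain ⟨q1, q2, q3⟩ := hex.choose_spec.choose_spec.choose_spec
    obtain ⟨r1, r2, r3⟩ := sorted_triple_unique h1' h2' q1 q2 q3
    have t1 := Fin.ext r1
    have t2 := Fin.ext r2
    have t3 := Fin.ext r3
    exact congrArg some (by congr 1)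
  refine ⟨_, hmono, ?_⟩
  intro i j k i' j' k' h1 h2 h3 h4
  exact Option.some.inj ((H _ _ _ (hmem i) (hmem j) (hmem k) (hmono h1) (hmono h2)).trans
    (H _ _ _ (hmem i') (hmem j') (hmem k') (hmono h3) (hmono h4)).symm)

theorem dist_sq_E2 (x c : E2) : dist x c ^ 2 = (x 0 - c 0) ^ 2 + (x 1 - c 1) ^ 2 := by
  rw [EuclideanSpace.dist_eq, Real.sq_sqrt (by positivity), Fin.sum_univ_two,
    Real.dist_eq, Real.dist_eq, sq_abs, sq_abs]

/-- polar coordinates -/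
theorem exists_polar (u v : ℝ) : ∃ m φ : ℝ, 0 ≤ m ∧ m ^ 2 = u ^ 2 + v ^ 2 ∧
    φ ∈ Set.Icc (-Real.pi) Real.pi ∧ u = m * Real.cos φ ∧ v = m * Real.sin φ := by
  refine ⟨‖(⟨u, v⟩ : ℂ)‖, Complex.arg ⟨u, v⟩, norm_nonneg _, ?_, ?_, ?_, ?_⟩
  · rw [Complex.sq_norm, Complex.normSq_mk]; ring
  · exact ⟨(Complex.neg_pi_lt_arg _).le, Complex.arg_le_pi _⟩
  · rw [Complex.norm_mul_cos_arg]
  · rw [Complex.norm_mul_sin_arg]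

theorem cos_between {a b t K d : ℝ} (ha : a ∈ Set.Icc (-Real.pi) Real.pi)
    (hb : b ∈ Set.Icc (-Real.pi) Real.pi) (hK : 0 ≤ K)
    (h1 : 0 < K * Real.cos a + d) (h2 : 0 < K * Real.cos b + d) (ht : t ∈ Set.Icc a b) :
    0 < K * Real.cos t + d := by
  have hmax : |t| ≤ |a| ∨ |t| ≤ |b| := by
    rcases le_total 0 t with h | h
    · right
      rw [abs_of_nonneg h]
      exact ht.2.trans (le_abs_self _)
    · left
      rw [abs_of_nonpos h]
      exact (neg_le_neg ht.1).trans (neg_le_abs a)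
  have aux : ∀ x, x ∈ Set.Icc (-Real.pi) Real.pi → |t| ≤ |x| → Real.cos x ≤ Real.cos t := by
    intro x hx h
    rw [← Real.cos_abs x, ← Real.cos_abs t]
    exact Real.cos_le_cos_of_nonneg_of_le_pi (abs_nonneg _) (abs_le.2 hx) h
  rcases hmax with h | h
  · have := mul_le_mul_of_nonneg_left (aux a ha h) hK; linarith
  · have := mul_le_mul_of_nonneg_left (aux b hb h) hK; linarith

/-- an open arc cut off a circle by a half-plane is preconnected -/
theorem arc_preconnected (c : E2) (r : ℝ) (hr : 0 < r) (u v d : ℝ) :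
    IsPreconnected {x : E2 | x ∈ Metric.sphere c r ∧
      0 < u * (x 0 - c 0) + v * (x 1 - c 1) + d} := by
  obtain ⟨m, φ, hm, -, -, hu, hv⟩ := exists_polar u v
  have hcs := Real.sin_sq_add_cos_sq φ
  let I : Set ℝ := {t | t ∈ Set.Icc (-Real.pi) Real.pi ∧ 0 < (m * r) * Real.cos t + d}
  have hI : IsPreconnected I := by
    apply Set.OrdConnected.isPreconnected
    refine ⟨fun a ha b hb t ht => ⟨⟨ha.1.1.trans ht.1, ht.2.trans hb.1.2⟩, ?_⟩⟩
    exact cos_between ha.1 hb.1 (by positivity) ha.2 hb.2 ht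
  let γ : ℝ → E2 := fun t => !₂[c 0 + r * (Real.cos t * Real.cos φ - Real.sin t * Real.sin φ),
    c 1 + r * (Real.cos t * Real.sin φ + Real.sin t * Real.cos φ)]
  have hγ : Continuous γ := by fun_prop
  have himg : {x : E2 | x ∈ Metric.sphere c r ∧
      0 < u * (x 0 - c 0) + v * (x 1 - c 1) + d} = γ '' I := by
    ext x
    constructor
    · rintro ⟨hx, hpos⟩
      rw [Metric.mem_sphere] at hx
      have hsq := dist_sq_E2 x c
      rw [hx] at hsq
      obtain ⟨m', t, hm', hm2, ht, h1, h2⟩ := exists_polar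
        ((x 0 - c 0) * Real.cos φ + (x 1 - c 1) * Real.sin φ)
        (-(x 0 - c 0) * Real.sin φ + (x 1 - c 1) * Real.cos φ)
      have : m' = r := by
        have : m' ^ 2 = r ^ 2 := by
          rw [hm2, hsq]
          linear_combination ((x 0 - c 0) ^ 2 + (x 1 - c 1) ^ 2) * hcs
        exact (pow_left_inj₀ hm' hr.le two_ne_zero).1 this
      subst this
      refine ⟨t, ⟨ht, ?_⟩, ?_⟩
      · rw [hu, hv] at hpos
        have : m * m' * Real.cos t + d =
          m * Real.cos φ * (x 0 - c 0) + m * Real.sin φ * (x 1 - c 1) + d := by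
          linear_combination (-m) * h1
        rw [this]; exact hpos
      · ext i
        fin_cases i
        · simp [γ]
          linear_combination (-Real.cos φ) * h1 + Real.sin φ * h2 + (x 0 - c 0) * hcs
        · simp [γ]
          linear_combination (-Real.sin φ) * h1 - Real.cos φ * h2 + (x 1 - c 1) * hcs
    · rintro ⟨t, ⟨ht, hpos⟩, rfl⟩
      have hct := Real.sin_sq_add_cos_sq t
      refine ⟨?_, ?_⟩
      · rw [Metric.mem_sphere]
        have : dist (γ t) c ^ 2 = r ^ 2 := by
          rw [dist_sq_E2]
          simp [γ]
          linear_combination r ^ 2 * hct + r ^ 2 * hcs * (Real.sin t ^ 2 + Real.cos t ^ 2)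
        exact (pow_left_inj₀ dist_nonneg hr.le two_ne_zero).1 this
      · have : u * ((γ t) 0 - c 0) + v * ((γ t) 1 - c 1) + d = m * r * Real.cos t + d := by
          simp [γ]
          rw [hu, hv]
          linear_combination m * r * Real.cos t * hcs
        rw [this]; exact hpos
  rw [himg]
  exact hI.image _ hγ.continuousOn

theorem arc_in (c : E2) (r : ℝ) (hr : 0 < r) (c' : E2) (r' : ℝ) (hr' : 0 < r') :
    IsPreconnected {x : E2 | x ∈ Metric.sphere c r ∧ dist x c' < r'} := by
  convert arc_preconnected c r hr (2 * (c' 0 - c 0)) (2 * (c' 1 - c 1))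
    (r' ^ 2 - r ^ 2 - (c' 0 - c 0) ^ 2 - (c' 1 - c 1) ^ 2) using 1
  ext x
  refine and_congr_right fun hx => ?_
  rw [Metric.mem_sphere] at hx
  have h1 := dist_sq_E2 x c
  have h2 := dist_sq_E2 x c'
  rw [hx] at h1
  rw [← pow_lt_pow_iff_left₀ dist_nonneg hr'.le two_ne_zero, h2]
  constructor <;> intro h <;> nlinarith

theorem arc_out (c : E2) (r : ℝ) (hr : 0 < r) (c' : E2) (r' : ℝ) (hr' : 0 < r') :
    IsPreconnected {x : E2 | x ∈ Metric.sphere c r ∧ r' < dist x c'} := by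
  convert arc_preconnected c r hr (-2 * (c' 0 - c 0)) (-2 * (c' 1 - c 1))
    (-(r' ^ 2 - r ^ 2 - (c' 0 - c 0) ^ 2 - (c' 1 - c 1) ^ 2)) using 1
  ext x
  refine and_congr_right fun hx => ?_
  rw [Metric.mem_sphere] at hx
  have h1 := dist_sq_E2 x c
  have h2 := dist_sq_E2 x c'
  rw [hx] at h1
  rw [← pow_lt_pow_iff_left₀ hr'.le dist_nonneg two_ne_zero, h2]
  constructor <;> intro h <;> nlinarith

theorem comp_eq (c : E2) (r : ℝ) (hr : 0 < r) (c' : E2) (r' : ℝ) (hr' : 0 < r') (p q : E2)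
    (hp : p ∈ Metric.sphere c r) (hq : q ∈ Metric.sphere c r)
    (h : (dist p c' < r' ∧ dist q c' < r') ∨ (r' < dist p c' ∧ r' < dist q c')) :
    connectedComponentIn (Metric.sphere c r \ (Metric.sphere c r ∩ Metric.sphere c' r')) p =
      connectedComponentIn (Metric.sphere c r \ (Metric.sphere c r ∩ Metric.sphere c' r')) q := by
  apply connectedComponentIn_eq
  rcases h with ⟨h1, h2⟩ | ⟨h1, h2⟩
  · refine (arc_in c r hr c' r' hr').subset_connectedComponentIn ⟨hp, h1⟩ ?_ ⟨hq, h2⟩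
    rintro x ⟨hx, hx'⟩
    exact ⟨hx, fun h => hx'.ne h.2⟩
  · refine (arc_out c r hr c' r' hr').subset_connectedComponentIn ⟨hp, h1⟩ ?_ ⟨hq, h2⟩
    rintro x ⟨hx, hx'⟩
    exact ⟨hx, fun h => hx'.ne' h.2⟩

theorem comp_ne (c : E2) (r : ℝ) (c' : E2) (r' : ℝ) (p q : E2)
    (hp : p ∈ Metric.sphere c r) (hq : q ∈ Metric.sphere c r)
    (h1 : dist p c' < r') (h2 : r' < dist q c') :
    connectedComponentIn (Metric.sphere c r \ (Metric.sphere c r ∩ Metric.sphere c' r')) p ≠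
      connectedComponentIn (Metric.sphere c r \ (Metric.sphere c r ∩ Metric.sphere c' r')) q := by
  intro heq
  set X := Metric.sphere c r \ (Metric.sphere c r ∩ Metric.sphere c' r')
  have hpX : p ∈ X := ⟨hp, fun h => h1.ne h.2⟩
  have hqX : q ∈ X := ⟨hq, fun h => h2.ne' h.2⟩
  have hp' := mem_connectedComponentIn hpX
  have hq' := mem_connectedComponentIn hqX
  rw [← heq] at hq'
  obtain ⟨x, hx, hxd⟩ := (isPreconnected_connectedComponentIn (F := X) (x := p)).intermediate_value
    hp' hq' (f := fun x => dist x c') (by fun_prop) ⟨h1.le, h2.le⟩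
  have := connectedComponentIn_subset X p hx
  exact this.2 ⟨this.1, hxd⟩

/-- orientation determinant -/
def orientDet (a b c : E2) : ℝ := (b 0 - a 0) * (c 1 - a 1) - (b 1 - a 1) * (c 0 - a 0)

theorem no_convex (c1 c2 c3 c4 : E2) (r1 r2 r3 r4 σ τ : ℝ) (x y : E2)
    (hx1 : dist x c1 ^ 2 - r1 ^ 2 = 0) (hx3 : dist x c3 ^ 2 - r3 ^ 2 = 0)
    (hx2 : 0 < σ * (dist x c2 ^ 2 - r2 ^ 2)) (hx4 : 0 < σ * (dist x c4 ^ 2 - r4 ^ 2))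
    (hy2 : dist y c2 ^ 2 - r2 ^ 2 = 0) (hy4 : dist y c4 ^ 2 - r4 ^ 2 = 0)
    (hy1 : 0 < σ * (dist y c1 ^ 2 - r1 ^ 2)) (hy3 : 0 < σ * (dist y c3 ^ 2 - r3 ^ 2))
    (h123 : 0 < τ * orientDet c1 c2 c3) (h124 : 0 < τ * orientDet c1 c2 c4)
    (h134 : 0 < τ * orientDet c1 c3 c4) (h234 : 0 < τ * orientDet c2 c3 c4) : False := by
  have key : orientDet c2 c3 c4 * (dist x c1 ^ 2 - r1 ^ 2)
      - orientDet c1 c3 c4 * (dist x c2 ^ 2 - r2 ^ 2)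
      + orientDet c1 c2 c4 * (dist x c3 ^ 2 - r3 ^ 2)
      - orientDet c1 c2 c3 * (dist x c4 ^ 2 - r4 ^ 2)
      = orientDet c2 c3 c4 * (dist y c1 ^ 2 - r1 ^ 2)
      - orientDet c1 c3 c4 * (dist y c2 ^ 2 - r2 ^ 2)
      + orientDet c1 c2 c4 * (dist y c3 ^ 2 - r3 ^ 2)
      - orientDet c1 c2 c3 * (dist y c4 ^ 2 - r4 ^ 2) := by
    simp only [dist_sq_E2, orientDet]; ring
  rw [hx1, hx3, hy2, hy4] at key
  have a1 := mul_pos h234 hy1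
  have a2 := mul_pos h134 hx2
  have a3 := mul_pos h124 hy3
  have a4 := mul_pos h123 hx4
  have := congrArg (fun t => τ * σ * t) key
  nlinarith

theorem no_collinear (c1 c2 c3 : E2) (r1 r2 r3 σ : ℝ) (x y z : E2)
    (hx1 : dist x c1 ^ 2 - r1 ^ 2 = 0) (hx2 : dist x c2 ^ 2 - r2 ^ 2 = 0)
    (hx3 : 0 < σ * (dist x c3 ^ 2 - r3 ^ 2))
    (hy1 : dist y c1 ^ 2 - r1 ^ 2 = 0) (hy3 : dist y c3 ^ 2 - r3 ^ 2 = 0)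
    (hy2 : 0 < σ * (dist y c2 ^ 2 - r2 ^ 2))
    (hz2 : dist z c2 ^ 2 - r2 ^ 2 = 0) (hz3 : dist z c3 ^ 2 - r3 ^ 2 = 0)
    (hz1 : 0 < σ * (dist z c1 ^ 2 - r1 ^ 2))
    (h123 : orientDet c1 c2 c3 = 0) : False := by
  obtain ⟨v, hv, hv0⟩ := Matrix.exists_vecMul_eq_zero_iff.2
    (show (!![1, c1 0, c1 1; 1, c2 0, c2 1; 1, c3 0, c3 1] : Matrix (Fin 3) (Fin 3) ℝ).det = 0 by
      rw [Matrix.det_fin_three]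
      simp
      rw [← h123]; unfold orientDet; ring)
  have e0 := congrFun hv0 0
  have e1 := congrFun hv0 1
  have e2 := congrFun hv0 2
  simp [Matrix.vecMul, dotProduct, Fin.sum_univ_three] at e0 e1 e2
  have hconst : ∀ p : E2, v 0 * (dist p c1 ^ 2 - r1 ^ 2) + v 1 * (dist p c2 ^ 2 - r2 ^ 2) +
      v 2 * (dist p c3 ^ 2 - r3 ^ 2) =
      v 0 * (c1 0 ^ 2 + c1 1 ^ 2 - r1 ^ 2) + v 1 * (c2 0 ^ 2 + c2 1 ^ 2 - r2 ^ 2) +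
      v 2 * (c3 0 ^ 2 + c3 1 ^ 2 - r3 ^ 2) := by
    intro p
    simp only [dist_sq_E2]
    linear_combination (p 0 ^ 2 + p 1 ^ 2) * e0 - 2 * p 0 * e1 - 2 * p 1 * e2
  have kx := hconst x
  have ky := hconst y
  have kz := hconst z
  rw [hx1, hx2] at kx
  rw [hy1, hy3] at ky
  rw [hz2, hz3] at kz
  generalize v 0 * (c1 0 ^ 2 + c1 1 ^ 2 - r1 ^ 2) + v 1 * (c2 0 ^ 2 + c2 1 ^ 2 - r2 ^ 2) +
      v 2 * (c3 0 ^ 2 + c3 1 ^ 2 - r3 ^ 2) = k at kx ky kz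
  have f3 : v 2 * (σ * (dist x c3 ^ 2 - r3 ^ 2)) = σ * k := by rw [← kx]; ring
  have f2 : v 1 * (σ * (dist y c2 ^ 2 - r2 ^ 2)) = σ * k := by rw [← ky]; ring
  have f1 : v 0 * (σ * (dist z c1 ^ 2 - r1 ^ 2)) = σ * k := by rw [← kz]; ring
  rcases lt_trichotomy (σ * k) 0 with h | h | h
  · have g1 := neg_of_mul_neg_left (f1.trans_lt h) hz1.le
    have g2 := neg_of_mul_neg_left (f2.trans_lt h) hy2.le
    have g3 := neg_of_mul_neg_left (f3.trans_lt h) hx3.le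
    linarith
  · rw [h] at f1 f2 f3
    apply hv
    ext i
    fin_cases i
    · exact (mul_eq_zero.1 f1).resolve_right hz1.ne'
    · exact (mul_eq_zero.1 f2).resolve_right hy2.ne'
    · exact (mul_eq_zero.1 f3).resolve_right hx3.ne'
  · have g1 := pos_of_mul_pos_left (h.trans_eq f1.symm) hz1.le
    have g2 := pos_of_mul_pos_left (h.trans_eq f2.symm) hy2.le
    have g3 := pos_of_mul_pos_left (h.trans_eq f3.symm) hx3.le
    linarith

theorem no_uniform (c : Fin 4 → E2) (r : Fin 4 → ℝ) (σ : ℝ)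
    (hσ : ∀ i j k, i ≠ j → i ≠ k → j ≠ k → ∀ p ∈ Metric.sphere (c j) (r j) ∩
      Metric.sphere (c k) (r k), 0 < σ * (dist p (c i) ^ 2 - r i ^ 2))
    (hne : ∀ i j, i ≠ j → ∃ p, p ∈ Metric.sphere (c i) (r i) ∩ Metric.sphere (c j) (r j))
    (t : SignType) (ht : ∀ i j k, i < j → j < k →
      SignType.sign (orientDet (c i) (c j) (c k)) = t) : False := by
  have hz : ∀ p i, p ∈ Metric.sphere (c i) (r i) → dist p (c i) ^ 2 - r i ^ 2 = 0 := by
    intro p i hp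
    rw [Metric.mem_sphere.1 hp, sub_self]
  by_cases h0 : t = 0
  · obtain ⟨x, hx⟩ := hne 0 1 (by decide)
    obtain ⟨y, hy⟩ := hne 0 2 (by decide)
    obtain ⟨z, hz'⟩ := hne 1 2 (by decide)
    refine no_collinear (c 0) (c 1) (c 2) (r 0) (r 1) (r 2) σ x y z (hz _ _ hx.1) (hz _ _ hx.2)
      (hσ 2 0 1 (by decide) (by decide) (by decide) x hx) (hz _ _ hy.1) (hz _ _ hy.2)
      (hσ 1 0 2 (by decide) (by decide) (by decide) y hy) (hz _ _ hz'.1) (hz _ _ hz'.2)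
      (hσ 0 1 2 (by decide) (by decide) (by decide) z hz') ?_
    exact sign_eq_zero_iff.1 ((ht 0 1 2 (by decide) (by decide)).trans h0)
  · have : ∃ τ : ℝ, ∀ i j k, i < j → j < k → 0 < τ * orientDet (c i) (c j) (c k) := by
      rcases SignType.trichotomy t with h | h | h
      · refine ⟨-1, fun i j k hij hjk => ?_⟩
        have := sign_eq_neg_one_iff.1 ((ht i j k hij hjk).trans h)
        linarith
      · exact absurd h h0
      · refine ⟨1, fun i j k hij hjk => ?_⟩
        have := sign_eq_one_iff.1 ((ht i j k hij hjk).trans h)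
        linarith
    obtain ⟨τ, hτ⟩ := this
    obtain ⟨x, hx⟩ := hne 0 2 (by decide)
    obtain ⟨y, hy⟩ := hne 1 3 (by decide)
    exact no_convex (c 0) (c 1) (c 2) (c 3) (r 0) (r 1) (r 2) (r 3) σ τ x y
      (hz _ _ hx.1) (hz _ _ hx.2)
      (hσ 1 0 2 (by decide) (by decide) (by decide) x hx)
      (hσ 3 0 2 (by decide) (by decide) (by decide) x hx)
      (hz _ _ hy.1) (hz _ _ hy.2)
      (hσ 0 1 3 (by decide) (by decide) (by decide) y hy)
      (hσ 2 1 3 (by decide) (by decide) (by decide) y hy)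
      (hτ 0 1 2 (by decide) (by decide)) (hτ 0 1 3 (by decide) (by decide))
      (hτ 0 2 3 (by decide) (by decide)) (hτ 1 2 3 (by decide) (by decide))

/-- all intersection points of circles `j`, `k` lie in the open disk of circle `i` -/
def InDisk {M : ℕ} (ctr : Fin M → E2) (rad : Fin M → ℝ) (i j k : Fin M) : Prop :=
  ∀ p ∈ Metric.sphere (ctr j) (rad j) ∩ Metric.sphere (ctr k) (rad k), dist p (ctr i) < rad i

theorem inDisk_comm {M : ℕ} (ctr : Fin M → E2) (rad : Fin M → ℝ) (i j k : Fin M) :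
    InDisk ctr rad i j k ↔ InDisk ctr rad i k j := by
  unfold InDisk
  rw [Set.inter_comm]

/-- For every `n ≥ 1` there is an `N` such that every arrangement of at least `N` circles in
which every triple is NonKrupp contains circles `C 0, C 1, …, C n` forming a rainbow
subarrangement: (I) all intersection points among `C 1, …, C n` lie in the open disk of
`C 0`, or all lie strictly outside its closed disk; (II) for distinct `i, j ∈ {1, …, n}`, the
two points of `C 0 ∩ C i` lie in the same connected component of `C 0 \ (C 0 ∩ C j)`; and
(III) for `1 ≤ i < j < k ≤ n`, the points of `C 0 ∩ C i` and the points of `C 0 ∩ C k` lie in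
different connected components of `C 0 \ (C 0 ∩ C j)`. -/
theorem stmt11 (n : ℕ) (hn : 1 ≤ n) :
    ∃ N : ℕ, ∀ M : ℕ, N ≤ M → ∀ ctr : Fin M → E2, ∀ rad : Fin M → ℝ,
      (∀ i, 0 < rad i) →
      (∀ i j : Fin M, i ≠ j → ∃ x y : E2, x ≠ y ∧
        Metric.sphere (ctr i) (rad i) ∩ Metric.sphere (ctr j) (rad j) = {x, y}) →
      (∀ i j k : Fin M, i ≠ j → i ≠ k → j ≠ k → ∀ x : E2,
        ¬ (x ∈ Metric.sphere (ctr i) (rad i) ∧ x ∈ Metric.sphere (ctr j) (rad j) ∧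
          x ∈ Metric.sphere (ctr k) (rad k))) →
      (∀ i j k : Fin M, i ≠ j → i ≠ k → j ≠ k →
        NonSepInt (ctr i) (rad i) (ctr j) (rad j) (ctr k) (rad k)) →
      ∃ g : Fin (n + 1) → Fin M, Function.Injective g ∧
        let S : Fin (n + 1) → Set E2 := fun i => Metric.sphere (ctr (g i)) (rad (g i))
        ((∀ i j : Fin (n + 1), 1 ≤ i.val → 1 ≤ j.val → i ≠ j →
            ∀ p ∈ S i ∩ S j, p ∈ Metric.ball (ctr (g 0)) (rad (g 0))) ∨
         (∀ i j : Fin (n + 1), 1 ≤ i.val → 1 ≤ j.val → i ≠ j →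
            ∀ p ∈ S i ∩ S j, rad (g 0) < dist p (ctr (g 0)))) ∧
        (∀ i j : Fin (n + 1), 1 ≤ i.val → 1 ≤ j.val → i ≠ j →
          ∀ p q : E2, p ∈ S 0 ∩ S i → q ∈ S 0 ∩ S i →
            connectedComponentIn (S 0 \ (S 0 ∩ S j)) p =
              connectedComponentIn (S 0 \ (S 0 ∩ S j)) q) ∧
        (∀ i j k : Fin (n + 1), 1 ≤ i.val → i < j → j < k →
          ∀ p q : E2, p ∈ S 0 ∩ S i → q ∈ S 0 ∩ S k →
            connectedComponentIn (S 0 \ (S 0 ∩ S j)) p ≠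
              connectedComponentIn (S 0 \ (S 0 ∩ S j)) q) := by
  classical
  obtain ⟨N, hN⟩ := ramsey_triple (K := Prop × Prop × Prop × SignType) (n + 4)
  refine ⟨N, fun M hM ctr rad hrad hint htri hnk => ?_⟩
  obtain ⟨e, hmono, he⟩ := hN M hM (fun i j k => (InDisk ctr rad i j k, InDisk ctr rad j i k,
    InDisk ctr rad k i j, SignType.sign (orientDet (ctr i) (ctr j) (ctr k))))
  have hout : ∀ i j k : Fin M, i ≠ j → i ≠ k → j ≠ k → ¬ InDisk ctr rad i j k →
      ∀ p ∈ Metric.sphere (ctr j) (rad j) ∩ Metric.sphere (ctr k) (rad k),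
        rad i < dist p (ctr i) := by
    intro i j k hij hik hjk hni p hp
    by_contra hcon
    have hlt : dist p (ctr i) < rad i := lt_of_le_of_ne (not_lt.1 hcon)
      (fun h => htri i j k hij hik hjk p ⟨h, hp.1, hp.2⟩)
    apply hni
    intro q hq
    obtain ⟨x, y, hxy, hset⟩ := hint j k hjk
    have hns := hnk i j k hij hik hjk x y hxy hset
    rw [hset] at hp hq
    simp only [Separates, Xor', xor_def, Metric.mem_ball] at hns
    simp only [Set.mem_insert_iff, Set.mem_singleton_iff] at hp hq
    rcases hp with rfl | rfl <;> rcases hq with rfl | rfl <;> tauto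
  have fin : ∀ g : Fin (n + 1) → Fin M, Function.Injective g → ∀ X : Prop,
      (∀ i j : Fin (n + 1), 1 ≤ i.val → i < j → (InDisk ctr rad (g 0) (g i) (g j) ↔ X)) →
      (∀ i j k : Fin (n + 1), 1 ≤ i.val → i < j → j < k →
        ¬ (InDisk ctr rad (g j) (g 0) (g i) ↔ InDisk ctr rad (g j) (g 0) (g k))) →
      ∃ g : Fin (n + 1) → Fin M, Function.Injective g ∧
        let S : Fin (n + 1) → Set E2 := fun i => Metric.sphere (ctr (g i)) (rad (g i))
        ((∀ i j : Fin (n + 1), 1 ≤ i.val → 1 ≤ j.val → i ≠ j →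
            ∀ p ∈ S i ∩ S j, p ∈ Metric.ball (ctr (g 0)) (rad (g 0))) ∨
         (∀ i j : Fin (n + 1), 1 ≤ i.val → 1 ≤ j.val → i ≠ j →
            ∀ p ∈ S i ∩ S j, rad (g 0) < dist p (ctr (g 0)))) ∧
        (∀ i j : Fin (n + 1), 1 ≤ i.val → 1 ≤ j.val → i ≠ j →
          ∀ p q : E2, p ∈ S 0 ∩ S i → q ∈ S 0 ∩ S i →
            connectedComponentIn (S 0 \ (S 0 ∩ S j)) p =
              connectedComponentIn (S 0 \ (S 0 ∩ S j)) q) ∧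
        (∀ i j k : Fin (n + 1), 1 ≤ i.val → i < j → j < k →
          ∀ p q : E2, p ∈ S 0 ∩ S i → q ∈ S 0 ∩ S k →
            connectedComponentIn (S 0 \ (S 0 ∩ S j)) p ≠
              connectedComponentIn (S 0 \ (S 0 ∩ S j)) q) := by
    intro g hg X hX hIII
    have hX' : ∀ i j : Fin (n + 1), 1 ≤ i.val → 1 ≤ j.val → i ≠ j →
        (InDisk ctr rad (g 0) (g i) (g j) ↔ X) := by
      intro i j hi hj hij
      rcases lt_or_gt_of_ne hij with h | h
      · exact hX i j hi h
      · rw [inDisk_comm]; exact hX j i hj h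
    have h0 : ∀ i : Fin (n + 1), 1 ≤ i.val → g 0 ≠ g i := by
      intro i hi h
      have := hg h
      rw [← this] at hi
      simp at hi
    refine ⟨g, hg, ?_, ?_, ?_⟩
    · by_cases h : X
      · left
        intro i j hi hj hij p hp
        exact (hX' i j hi hj hij).2 h p hp
      · right
        intro i j hi hj hij p hp
        exact hout _ _ _ (h0 i hi) (h0 j hj) (hg.ne hij) (fun h' => h ((hX' i j hi hj hij).1 h')) p hp
    · intro i j hi hj hij p q hp hq
      apply comp_eq _ _ (hrad _) _ _ (hrad _) p q hp.1 hq.1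
      by_cases h : InDisk ctr rad (g j) (g 0) (g i)
      · exact Or.inl ⟨h p hp, h q hq⟩
      · have := hout _ _ _ (h0 j hj).symm (hg.ne hij.symm) (h0 i hi) h
        exact Or.inr ⟨this p hp, this q hq⟩
    · intro i j k hi hij hjk p q hp hq
      have hi' : i.val < j.val := hij
      have hj' : j.val < k.val := hjk
      have hne := hIII i j k hi hij hjk
      by_cases h : InDisk ctr rad (g j) (g 0) (g i)
      · have h2 : ¬ InDisk ctr rad (g j) (g 0) (g k) := fun h2 => hne ⟨fun _ => h2, fun _ => h⟩
        exact comp_ne _ _ _ _ p q hp.1 hq.1 (h p hp)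
          (hout _ _ _ (h0 j (by omega)).symm (hg.ne hjk.ne) (h0 k (by omega)) h2 q hq)
      · have h2 : InDisk ctr rad (g j) (g 0) (g k) := by
          by_contra h2
          exact hne ⟨fun h' => absurd h' h, fun h' => absurd h' h2⟩
        exact (comp_ne _ _ _ _ q p hq.1 hp.1 (h2 q hq)
          (hout _ _ _ (h0 j (by omega)).symm (hg.ne hij.ne') (h0 i hi) h p hp)).symm
  have hcol : ∃ (X Y Z : Prop) (t : SignType), ∀ i j k, i < j → j < k →
      (InDisk ctr rad (e i) (e j) (e k) ↔ X) ∧ (InDisk ctr rad (e j) (e i) (e k) ↔ Y) ∧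
      (InDisk ctr rad (e k) (e i) (e j) ↔ Z) ∧
      SignType.sign (orientDet (ctr (e i)) (ctr (e j)) (ctr (e k))) = t := by
    let a0 : Fin (n + 4) := ⟨0, by omega⟩
    let a1 : Fin (n + 4) := ⟨1, by omega⟩
    let a2 : Fin (n + 4) := ⟨2, by omega⟩
    refine ⟨InDisk ctr rad (e a0) (e a1) (e a2), InDisk ctr rad (e a1) (e a0) (e a2),
      InDisk ctr rad (e a2) (e a0) (e a1),
      SignType.sign (orientDet (ctr (e a0)) (ctr (e a1)) (ctr (e a2))), fun i j k hij hjk => ?_⟩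
    have := he i j k a0 a1 a2 hij hjk
      (Fin.mk_lt_mk.2 (by omega)) (Fin.mk_lt_mk.2 (by omega))
    simp only [Prod.mk.injEq, eq_iff_iff] at this
    exact this
  obtain ⟨X, Y, Z, t, hcol⟩ := hcol
  by_cases hYZ : Y ↔ Z
  swap
  · -- take the first circle as `C 0`
    have hlt : ∀ i : Fin (n + 1), i.val < n + 4 := fun i => by omega
    refine fin (fun i => e ⟨i.val, hlt i⟩) ?_ X ?_ ?_
    · intro i j h
      have := hmono.injective h
      simpa [Fin.ext_iff] using this
    · intro i j hi hij
      exact (hcol _ _ _ (by rw [Fin.mk_lt_mk]; exact hi) (by rw [Fin.mk_lt_mk]; exact hij)).1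
    · intro i j k hi hij hjk h
      have hi' : i.val < j.val := hij
      have a1 := (hcol ⟨(0 : Fin (n + 1)).val, hlt 0⟩ ⟨i.val, hlt i⟩ ⟨j.val, hlt j⟩
        (by rw [Fin.mk_lt_mk]; exact hi) (by rw [Fin.mk_lt_mk]; exact hij)).2.2.1
      have a2 := (hcol ⟨(0 : Fin (n + 1)).val, hlt 0⟩ ⟨j.val, hlt j⟩ ⟨k.val, hlt k⟩
        (by simp only [Fin.lt_def, Fin.val_zero]; omega) (by rw [Fin.mk_lt_mk]; exact hjk)).2.1
      exact hYZ (a2.symm.trans (h.symm.trans a1))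
  by_cases hXY : X ↔ Y
  swap
  · -- take the last circle as `C 0`
    have hlt : ∀ i : Fin (n + 1), (if i.val = 0 then n + 3 else i.val - 1) < n + 4 := fun i => by
      split_ifs <;> omega
    have hv0 : ∀ h, (⟨if (0 : Fin (n + 1)).val = 0 then n + 3 else (0 : Fin (n + 1)).val - 1, h⟩ :
      Fin (n + 4)) = ⟨n + 3, by omega⟩ := fun h => by simp
    have hv : ∀ (i : Fin (n + 1)) (_ : 1 ≤ i.val) (h), (⟨if i.val = 0 then n + 3 else i.val - 1, h⟩ :
      Fin (n + 4)) = ⟨i.val - 1, by omega⟩ := fun i hi h => by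
        have : i.val ≠ 0 := by omega
        simp [this]
    refine fin (fun i => e ⟨if i.val = 0 then n + 3 else i.val - 1, hlt i⟩) ?_ Z ?_ ?_
    · intro i j h
      have := Fin.mk.inj_iff.1 (hmono.injective h)
      apply Fin.ext
      split_ifs at this <;> omega
    · intro i j hi hij
      have hij' : i.val < j.val := hij
      simp only [hv0, hv i hi, hv j (by omega)]
      exact (hcol _ _ _ (by simp only [Fin.lt_def]; omega) (by simp only [Fin.lt_def]; omega)).2.2.1
    · intro i j k hi hij hjk h
      have hij' : i.val < j.val := hij
      have hjk' : j.val < k.val := hjk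
      simp only [hv0, hv i hi, hv j (by omega), hv k (by omega)] at h
      have a1 := (hcol ⟨i.val - 1, by omega⟩ ⟨j.val - 1, by omega⟩ ⟨n + 3, by omega⟩
        (by simp only [Fin.lt_def]; omega) (by simp only [Fin.lt_def]; omega)).2.1
      have a2 := (hcol ⟨j.val - 1, by omega⟩ ⟨k.val - 1, by omega⟩ ⟨n + 3, by omega⟩
        (by simp only [Fin.lt_def]; omega) (by simp only [Fin.lt_def]; omega)).1
      rw [inDisk_comm] at a1 a2
      exact hXY (a2.symm.trans (h.symm.trans a1))
  -- the uniform case is impossible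
  exfalso
  have hun : ∀ i j k, i ≠ j → i ≠ k → j < k → (InDisk ctr rad (e i) (e j) (e k) ↔ X) := by
    intro i j k hij hik hjk
    rcases lt_or_gt_of_ne hij with h1 | h1
    · exact (hcol i j k h1 hjk).1
    · rcases lt_or_gt_of_ne hik with h2 | h2
      · exact (hcol j i k h1 h2).2.1.trans hXY.symm
      · exact (hcol j k i hjk h2).2.2.1.trans (hXY.trans hYZ).symm
  have hun' : ∀ i j k, i ≠ j → i ≠ k → j ≠ k → (InDisk ctr rad (e i) (e j) (e k) ↔ X) := by
    intro i j k hij hik hjk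
    rcases lt_or_gt_of_ne hjk with h | h
    · exact hun i j k hij hik h
    · rw [inDisk_comm]; exact hun i k j hik hij h
  let w : Fin 4 → Fin (n + 4) := fun i => ⟨i.val, by omega⟩
  have hw : Function.Injective w := fun i j h => Fin.ext (Fin.mk.inj_iff.1 h)
  refine no_uniform (fun i => ctr (e (w i))) (fun i => rad (e (w i))) (if X then -1 else 1)
    ?_ ?_ t ?_
  · intro i j k hij hik hjk p hp
    have hu := hun' _ _ _ (hw.ne hij) (hw.ne hik) (hw.ne hjk)
    by_cases h : X
    · have h1 := hu.2 h p hp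
      have h2 := pow_lt_pow_left₀ h1 dist_nonneg two_ne_zero
      rw [if_pos h]
      linarith
    · have h1 := hout _ _ _ (hmono.injective.ne (hw.ne hij)) (hmono.injective.ne (hw.ne hik))
        (hmono.injective.ne (hw.ne hjk)) (fun h' => h (hu.1 h')) p hp
      have h2 := pow_lt_pow_left₀ h1 (hrad _).le two_ne_zero
      rw [if_neg h]
      linarith
  · intro i j hij
    obtain ⟨x, y, -, hset⟩ := hint _ _ (hmono.injective.ne (hw.ne hij))
    exact ⟨x, by rw [hset]; simp⟩
  · intro i j k hij hjk
    exact (hcol (w i) (w j) (w k) hij hjk).2.2.2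
end
end
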